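/- Fix an integer k ≥ 2, constants a₁,…,a_{k-1} > 0 and b > 0. Consider the polynomial ODE system in (x̄, z̄) ∈ ℝ^{k-1} × ℝ: x̄₁' = −a₁ x̄₁ + b z̄; x̄ⱼ' = −aⱼ x̄ⱼ for j = 2,…,k−1; z̄' = −(z̄^k + Σ_{i=1}^{k-1} x̄ᵢ z̄^{i−1}). Then the origin is locally asymptotically stable: (i) for every η > 0 there exists δ > 0 such that every solution defined on [0,∞) with initial norm less than δ stays within norm η for all t ≥ 0; and (ii) there exists δ₀ > 0 such that every solution defined on [0,∞) with initial norm less than δ₀ converges to the origin as t → ∞. -/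

import Mathlib

open Filter

/-- A trajectory along which a coercive function `V` decays at rate `m` whenever it lies in the ball
of radius `ρ` stays in that ball, provided `V` starts below its lower bound on the sphere. -/
theorem norm_lt_of_lyapunov {E : Type*} [NormedAddCommGroup E] {V W : E → ℝ} {κ m ρ : ℝ}
    (hκ : 0 < κ) (hm : 0 < m) (hρ : 0 < ρ) (hV : ∀ p, κ * ‖p‖ ^ 2 ≤ V p)
    (hW : ∀ p, ‖p‖ < ρ → W p ≤ -m * V p) {sol : ℝ → E}
    (hc : ∀ t, 0 ≤ t → ContinuousAt sol t)
    (hd : ∀ t, 0 ≤ t → HasDerivAt (fun s => V (sol s)) (W (sol t)) t)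
    (hV0 : V (sol 0) < κ * ρ ^ 2) {t : ℝ} (ht : 0 ≤ t) : ‖sol t‖ < ρ := by
  by_contra! hcon
  have hcont : ContinuousOn (fun s => ‖sol s‖) (Set.Icc 0 t) := fun s hs =>
    (hc s hs.1).norm.continuousWithinAt
  have hcpt : IsCompact (Set.Icc 0 t ∩ (fun s => ‖sol s‖) ⁻¹' Set.Ici ρ) :=
    isCompact_Icc.of_isClosed_subset (hcont.preimage_isClosed_of_isClosed isClosed_Icc isClosed_Ici)
      Set.inter_subset_left
  obtain ⟨T, ⟨hT, hTρ⟩, hmin⟩ := hcpt.exists_isLeast ⟨t, ⟨ht, le_rfl⟩, hcon⟩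
  have hanti : AntitoneOn (fun s => V (sol s)) (Set.Icc 0 T) := by
    refine antitoneOn_of_hasDerivWithinAt_nonpos (convex_Icc 0 T)
      (fun s hs => (hd s hs.1).continuousAt.continuousWithinAt)
      (f' := fun s => W (sol s)) (fun s hs => ?_) (fun s hs => ?_)
    all_goals rw [interior_Icc] at hs
    · exact (hd s hs.1.le).hasDerivWithinAt
    · have hs' : ‖sol s‖ < ρ := by
        by_contra! hle
        exact absurd (hmin ⟨⟨hs.1.le, hs.2.le.trans hT.2⟩, hle⟩) (not_le.2 hs.2)
      have hnonneg : 0 ≤ V (sol s) := le_trans (by positivity) (hV _)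
      nlinarith [hW _ hs', mul_nonneg hm.le hnonneg]
  have hle : V (sol T) ≤ V (sol 0) := hanti ⟨le_rfl, hT.1⟩ ⟨hT.1, le_rfl⟩ hT.1
  have hTρ' : ρ ≤ ‖sol T‖ := hTρ
  have : κ * ρ ^ 2 ≤ κ * ‖sol T‖ ^ 2 := by gcongr
  linarith [hV (sol T)]

/-- A trajectory that stays in the region where `V` decays at rate `m` converges to the origin. -/
theorem tendsto_zero_of_lyapunov {E : Type*} [NormedAddCommGroup E] {V W : E → ℝ} {κ m ρ : ℝ}
    (hκ : 0 < κ) (hm : 0 < m) (hV : ∀ p, κ * ‖p‖ ^ 2 ≤ V p)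
    (hW : ∀ p, ‖p‖ < ρ → W p ≤ -m * V p) {sol : ℝ → E}
    (hd : ∀ t, 0 ≤ t → HasDerivAt (fun s => V (sol s)) (W (sol t)) t)
    (hρ : ∀ t, 0 ≤ t → ‖sol t‖ < ρ) : Tendsto sol atTop (nhds 0) := by
  have hd' : ∀ t, 0 ≤ t → HasDerivAt (fun s => V (sol s) * Real.exp (m * s))
      (W (sol t) * Real.exp (m * t) + V (sol t) * (Real.exp (m * t) * m)) t := fun t ht => by
    simpa using (hd t ht).fun_mul ((hasDerivAt_id t).const_mul m).exp
  have hanti : AntitoneOn (fun s => V (sol s) * Real.exp (m * s)) (Set.Ici 0) := by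
    refine antitoneOn_of_hasDerivWithinAt_nonpos (convex_Ici 0)
      (fun s hs => (hd' s hs).continuousAt.continuousWithinAt)
      (fun s hs => (hd' s (interior_subset hs)).hasDerivWithinAt) (fun s hs => ?_)
    have h := hW _ (hρ s (interior_subset hs))
    nlinarith [Real.exp_pos (m * s)]
  have hbound : ∀ᶠ t in atTop, ‖sol t‖ ^ 2 ≤ V (sol 0) / κ * Real.exp (-(m * t)) := by
    filter_upwards [eventually_ge_atTop 0] with t ht
    have h : V (sol t) * Real.exp (m * t) ≤ V (sol 0) := by
      simpa using hanti (Set.mem_Ici.2 le_rfl) (Set.mem_Ici.2 ht) ht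
    rw [← le_div_iff₀ (Real.exp_pos _), div_eq_mul_inv, ← Real.exp_neg] at h
    rw [div_mul_eq_mul_div, le_div_iff₀ hκ, mul_comm]
    exact (hV _).trans h
  have hexp : Tendsto (fun t => V (sol 0) / κ * Real.exp (-(m * t))) atTop (nhds 0) := by
    simpa using (Real.tendsto_exp_neg_atTop_nhds_zero.comp
      (tendsto_id.const_mul_atTop hm)).const_mul (V (sol 0) / κ)
  have hsq : Tendsto (fun t => ‖sol t‖ ^ 2) atTop (nhds 0) :=
    squeeze_zero' (Eventually.of_forall fun t => by positivity) hbound hexp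
  rw [tendsto_zero_iff_norm_tendsto_zero]
  simpa [Real.sqrt_sq] using hsq.sqrt

/-- The direct method of Lyapunov, with a coercive function decaying at an exponential rate, for the
trajectories satisfying a predicate `P`. -/
theorem asymptotically_stable_of_lyapunov {E : Type*} [NormedAddCommGroup E]
    {P : (ℝ → E) → Prop} {V W : E → ℝ} {κ m r : ℝ}
    (hκ : 0 < κ) (hm : 0 < m) (hr : 0 < r) (hV : ∀ p, κ * ‖p‖ ^ 2 ≤ V p)
    (hVc : ContinuousAt V 0) (hV0 : V 0 = 0)
    (hW : ∀ p, ‖p‖ < r → W p ≤ -m * V p)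
    (hc : ∀ sol, P sol → ∀ t, 0 ≤ t → ContinuousAt sol t)
    (hd : ∀ sol, P sol → ∀ t, 0 ≤ t → HasDerivAt (fun s => V (sol s)) (W (sol t)) t) :
    (∀ η > (0 : ℝ), ∃ δ > (0 : ℝ), ∀ sol, P sol → ‖sol 0‖ < δ → ∀ t : ℝ, 0 ≤ t → ‖sol t‖ < η) ∧
      ∃ δ > (0 : ℝ), ∀ sol, P sol → ‖sol 0‖ < δ → Tendsto sol atTop (nhds 0) := by
  have key : ∀ ρ, 0 < ρ → ρ ≤ r → ∃ δ > (0 : ℝ), ∀ sol, P sol → ‖sol 0‖ < δ →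
      ∀ t : ℝ, 0 ≤ t → ‖sol t‖ < ρ := by
    intro ρ hρ hρr
    have hev : ∀ᶠ p in nhds (0 : E), V p < κ * ρ ^ 2 :=
      hVc.eventually_lt_const (by rw [hV0]; positivity)
    obtain ⟨δ, hδ, hsub⟩ := Metric.eventually_nhds_iff.1 hev
    exact ⟨δ, hδ, fun sol hsol h0 t ht =>
      norm_lt_of_lyapunov hκ hm hρ hV (fun p hp => hW p (hp.trans_le hρr)) (hc sol hsol)
        (hd sol hsol) (hsub (by simpa using h0)) ht⟩
  refine ⟨fun η hη => ?_, ?_⟩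
  · obtain ⟨δ, hδ, h⟩ := key (min η r) (lt_min hη hr) (min_le_right _ _)
    exact ⟨δ, hδ, fun sol hsol h0 t ht => (h sol hsol h0 t ht).trans_le (min_le_left _ _)⟩
  · obtain ⟨δ, hδ, h⟩ := key r hr le_rfl
    exact ⟨δ, hδ, fun sol hsol h0 =>
      tendsto_zero_of_lyapunov hκ hm hV hW (hd sol hsol) (h sol hsol h0)⟩

section DesingularizedSystem

variable {n : ℕ}

/-- The quadratic Lyapunov function: the energy of the oscillator `(x₀, z)` with a cross term of
size `c`, plus the energy of the uncoupled variables. -/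
def lyapunovForm (b c : ℝ) (p : (Fin (n + 1) → ℝ) × ℝ) : ℝ :=
  p.1 0 ^ 2 + b * p.2 ^ 2 - 2 * c * (p.1 0 * p.2) + ∑ j : Fin n, p.1 j.succ ^ 2

/-- The higher order part of `-z'`, divided by `z`. -/
def higherOrderFactor (p : (Fin (n + 1) → ℝ) × ℝ) : ℝ :=
  p.2 ^ (n + 1) + ∑ j : Fin n, p.1 j.succ * p.2 ^ (j : ℕ)

/-- The derivative of `lyapunovForm` along solutions. -/
def lyapunovOrbitalDeriv (a : Fin (n + 1) → ℝ) (b c : ℝ) (p : (Fin (n + 1) → ℝ) × ℝ) : ℝ :=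
  -2 * (a 0 - c) * p.1 0 ^ 2 + 2 * c * a 0 * (p.1 0 * p.2) - 2 * c * b * p.2 ^ 2
    - 2 * b * p.2 ^ 2 * higherOrderFactor p + 2 * c * (p.1 0 * p.2) * higherOrderFactor p
    - 2 * ∑ j : Fin n, a j.succ * p.1 j.succ ^ 2

/-- `sol` solves the system on `[0, ∞)`. -/
def IsDesingularizedSolution (a : Fin (n + 1) → ℝ) (b : ℝ)
    (sol : ℝ → (Fin (n + 1) → ℝ) × ℝ) : Prop :=
  ∀ t : ℝ, 0 ≤ t → HasDerivAt sol
    ((fun i => (if i = 0 then b * (sol t).2 else 0) - a i * (sol t).1 i,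
      -((sol t).2 ^ (n + 2) + ∑ i : Fin (n + 1), (sol t).1 i * (sol t).2 ^ (i : ℕ)))) t

theorem IsDesingularizedSolution.hasDerivAt_lyapunovForm {a : Fin (n + 1) → ℝ} {b : ℝ} (c : ℝ)
    {sol : ℝ → (Fin (n + 1) → ℝ) × ℝ} (h : IsDesingularizedSolution a b sol) {t : ℝ}
    (ht : 0 ≤ t) :
    HasDerivAt (fun s => lyapunovForm b c (sol s)) (lyapunovOrbitalDeriv a b c (sol t)) t := by
  have hx := hasDerivAt_pi.1 (h t ht).fst
  have hz : HasDerivAt (fun s => (sol s).2)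
      (-((sol t).2 ^ (n + 2) + ∑ i : Fin (n + 1), (sol t).1 i * (sol t).2 ^ (i : ℕ))) t :=
    (h t ht).snd
  have hx0 := hx 0
  have hxs := HasDerivAt.fun_sum (u := Finset.univ) fun (j : Fin n) _ => (hx j.succ).fun_pow 2
  have hV := (((hx0.fun_pow 2).fun_add ((hz.fun_pow 2).const_mul b)).fun_sub
    ((hx0.fun_mul hz).const_mul (2 * c))).fun_add hxs
  refine hV.congr_deriv ?_
  have hR : (sol t).2 ^ (n + 2) + ∑ i : Fin (n + 1), (sol t).1 i * (sol t).2 ^ (i : ℕ)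
      = (sol t).1 0 + (sol t).2 * higherOrderFactor (sol t) := by
    rw [Fin.sum_univ_succ, higherOrderFactor, mul_add, Finset.mul_sum]
    simp only [Fin.val_zero, Fin.val_succ, pow_succ, pow_zero]
    have : ∀ j : Fin n, (sol t).1 j.succ * ((sol t).2 ^ (j : ℕ) * (sol t).2)
        = (sol t).2 * ((sol t).1 j.succ * (sol t).2 ^ (j : ℕ)) := fun j => by ring
    simp only [this]
    ring
  have hS : ∑ j : Fin n, 2 * (sol t).1 j.succ * (0 - a j.succ * (sol t).1 j.succ)
      = -(2 * ∑ j : Fin n, a j.succ * (sol t).1 j.succ ^ 2) := by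
    rw [Finset.mul_sum, ← Finset.sum_neg_distrib]
    exact Finset.sum_congr rfl fun j _ => by ring
  simp only [hR, Fin.succ_ne_zero, if_true, if_false, Nat.cast_ofNat, Nat.add_one_sub_one,
    pow_one, hS, lyapunovOrbitalDeriv]
  ring

theorem lyapunovForm_lower_bound {b c : ℝ} (hb : 0 < b) (hcb : 4 * c ^ 2 ≤ b)
    (p : (Fin (n + 1) → ℝ) × ℝ) : min (1 / 2) (b / 2) * ‖p‖ ^ 2 ≤ lyapunovForm b c p := by
  have hsum : ∀ i, p.1 i ^ 2 ≤ p.1 0 ^ 2 + ∑ j : Fin n, p.1 j.succ ^ 2 := fun i => by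
    rw [← Fin.sum_univ_succ (fun i => p.1 i ^ 2)]
    exact Finset.single_le_sum (f := fun i => p.1 i ^ 2) (fun _ _ => sq_nonneg _)
      (Finset.mem_univ i)
  have hs : 0 ≤ ∑ j : Fin n, p.1 j.succ ^ 2 := Finset.sum_nonneg fun _ _ => sq_nonneg _
  have hlow : 1 / 2 * (p.1 0 ^ 2 + ∑ j : Fin n, p.1 j.succ ^ 2) + b / 2 * p.2 ^ 2
      ≤ lyapunovForm b c p := by
    rw [lyapunovForm]
    nlinarith [sq_nonneg (p.1 0 - 2 * c * p.2), mul_nonneg (sub_nonneg.2 hcb) (sq_nonneg p.2)]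
  have hz : 0 ≤ b / 2 * p.2 ^ 2 := by positivity
  rcases max_choice ‖p.1‖ ‖p.2‖ with h | h
  · have hx : ‖p.1‖ ^ 2 ≤ p.1 0 ^ 2 + ∑ j : Fin n, p.1 j.succ ^ 2 :=
      (Real.le_sqrt (norm_nonneg _) (by positivity)).1 <| (pi_norm_le_iff_of_nonneg (Real.sqrt_nonneg _)).2
        fun i => Real.abs_le_sqrt (hsum i)
    rw [Prod.norm_def, h]
    nlinarith [mul_le_mul_of_nonneg_right (min_le_left (1 / 2) (b / 2)) (sq_nonneg ‖p.1‖)]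
  · rw [Prod.norm_def, h, Real.norm_eq_abs, sq_abs]
    nlinarith [mul_le_mul_of_nonneg_right (min_le_right (1 / 2) (b / 2)) (sq_nonneg p.2),
      sq_nonneg (p.1 0)]

theorem lyapunovOrbitalDeriv_le {a : Fin (n + 1) → ℝ} {b c ε m : ℝ} (hb : 0 < b) (hc : 0 < c)
    (hm : 0 < m) (ha0 : 0 < a 0) (hca : 2 * c ≤ a 0) (hcb : 4 * c ^ 2 ≤ b) (hcab : 2 * c * a 0 ≤ b)
    (hεa : ε * c ≤ a 0 / 4) (hεb : ε * (2 * b + c) ≤ c * b / 2)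
    (hma : ∀ i, 8 * m ≤ a i) (hmc : 4 * m ≤ c)
    {p : (Fin (n + 1) → ℝ) × ℝ} (hp : |higherOrderFactor p| ≤ ε) :
    lyapunovOrbitalDeriv a b c p ≤ -m * lyapunovForm b c p := by
  rw [lyapunovOrbitalDeriv, lyapunovForm]
  generalize higherOrderFactor p = S at hp
  have hs : m * ∑ j : Fin n, p.1 j.succ ^ 2 ≤ 2 * ∑ j : Fin n, a j.succ * p.1 j.succ ^ 2 := by
    rw [Finset.mul_sum, Finset.mul_sum]
    refine Finset.sum_le_sum fun j _ => ?_
    nlinarith [hma j.succ, sq_nonneg (p.1 j.succ)]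
  generalize (∑ j : Fin n, p.1 j.succ ^ 2) = s at hs
  generalize (∑ j : Fin n, a j.succ * p.1 j.succ ^ 2) = s' at hs
  have hma0 := hma 0
  generalize p.1 0 = x at *
  generalize p.2 = z at *
  generalize a 0 = α at *
  have hV : x ^ 2 + b * z ^ 2 - 2 * c * (x * z) ≤ 2 * x ^ 2 + 2 * b * z ^ 2 := by
    nlinarith [sq_nonneg (x + c * z), mul_nonneg (sub_nonneg.2 hcb) (sq_nonneg z),
      mul_nonneg hb.le (sq_nonneg z)]
  have hcross : 2 * c * α * (x * z) ≤ α / 2 * x ^ 2 + c * b * z ^ 2 := by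
    have h : 2 * c ^ 2 * α ≤ c * b := by nlinarith
    nlinarith [mul_nonneg ha0.le (sq_nonneg (x - 2 * c * z)),
      mul_nonneg (sub_nonneg.2 h) (sq_nonneg z)]
  have hx : 2 * c * x ^ 2 ≤ α * x ^ 2 := by gcongr
  have hS := abs_le.1 hp
  have hpert₁ : -(2 * b * z ^ 2 * S) ≤ 2 * b * z ^ 2 * ε := by
    nlinarith [mul_nonneg hb.le (sq_nonneg z)]
  have hpert₂ : 2 * c * (x * z) * S ≤ c * (x ^ 2 + z ^ 2) * ε := by
    have h₁ : 2 * (x * z) * S ≤ (x ^ 2 + z ^ 2) * ε := by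
      nlinarith [mul_nonneg (sub_nonneg.2 hS.2) (sq_nonneg (x + z)),
        mul_nonneg (neg_le_iff_add_nonneg.1 hS.1) (sq_nonneg (x - z))]
    nlinarith
  have hεx := mul_le_mul_of_nonneg_right hεa (sq_nonneg x)
  have hεz := mul_le_mul_of_nonneg_right hεb (sq_nonneg z)
  have hmx := mul_le_mul_of_nonneg_right hma0 (sq_nonneg x)
  have hmz := mul_le_mul_of_nonneg_right hmc (mul_nonneg hb.le (sq_nonneg z))
  have hmV := mul_le_mul_of_nonneg_left hV hm.le
  linarith

theorem continuous_lyapunovForm (b c : ℝ) :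
    Continuous (lyapunovForm b c : (Fin (n + 1) → ℝ) × ℝ → ℝ) := by
  unfold lyapunovForm
  fun_prop

theorem continuous_higherOrderFactor :
    Continuous (higherOrderFactor : (Fin (n + 1) → ℝ) × ℝ → ℝ) := by
  unfold higherOrderFactor
  fun_prop

theorem exists_pos_mul_le {ι : Type*} [Finite ι] (C : ι → ℝ) {d : ι → ℝ} (hd : ∀ i, 0 < d i) :
    ∃ ε > (0 : ℝ), ∀ i, ε * C i ≤ d i := by
  have h : ∀ᶠ ε in nhdsWithin (0 : ℝ) (Set.Ioi 0), ∀ i, ε * C i < d i :=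
    eventually_all.2 fun i => (((continuous_id.mul continuous_const).tendsto' 0 0
      (by simp)).eventually_lt_const (hd i)).filter_mono nhdsWithin_le_nhds
  obtain ⟨ε, hε, hpos⟩ := (h.and self_mem_nhdsWithin).exists
  exact ⟨ε, hpos, fun i => (hε i).le⟩

theorem desingularizedSolution_asymptotically_stable {a : Fin (n + 1) → ℝ} (ha : ∀ i, 0 < a i)
    {b : ℝ} (hb : 0 < b) :
    (∀ η > (0 : ℝ), ∃ δ > (0 : ℝ), ∀ sol, IsDesingularizedSolution a b sol →
      ‖sol 0‖ < δ → ∀ t : ℝ, 0 ≤ t → ‖sol t‖ < η) ∧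
    ∃ δ > (0 : ℝ), ∀ sol, IsDesingularizedSolution a b sol →
      ‖sol 0‖ < δ → Tendsto sol atTop (nhds 0) := by
  have ha0 := ha 0
  obtain ⟨c, hc, hcle⟩ := exists_pos_mul_le ![2, 4, 2 * a 0] (d := ![a 0, b, b])
    (by simp [Fin.forall_fin_succ, ha0, hb])
  obtain ⟨c, hc, hca, hcb, hcab⟩ :
      ∃ c > 0, 2 * c ≤ a 0 ∧ 4 * c ^ 2 ≤ b ∧ 2 * c * a 0 ≤ b := by
    simp only [Fin.forall_fin_succ, Matrix.cons_val_zero, Matrix.cons_val_succ] at hcle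
    obtain ⟨h₁, h₂, h₃, -⟩ := hcle
    have hle := min_le_left c 1
    have hpos : 0 < min c 1 := lt_min hc one_pos
    exact ⟨min c 1, hpos, by linarith, by nlinarith [min_le_right c 1], by nlinarith⟩
  obtain ⟨ε, hε, hεle⟩ := exists_pos_mul_le ![c, 2 * b + c] (d := ![a 0 / 4, c * b / 2])
    (by simp [Fin.forall_fin_succ, ha0, hb, hc])
  simp only [Fin.forall_fin_succ, Matrix.cons_val_zero, Matrix.cons_val_succ] at hεle
  obtain ⟨m, hm, hmle⟩ := exists_pos_mul_le (Option.elim · 4 fun _ : Fin (n + 1) => (8 : ℝ))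
    (d := (Option.elim · c a)) (by simp [Option.forall, ha, hc])
  simp only [Option.forall, Option.elim_none, Option.elim_some] at hmle
  have hS : ∀ᶠ p in nhds (0 : (Fin (n + 1) → ℝ) × ℝ), |higherOrderFactor p| < ε :=
    continuous_higherOrderFactor.abs.continuousAt.eventually_lt_const
      (by simpa [higherOrderFactor] using hε)
  obtain ⟨r, hr, hball⟩ := Metric.eventually_nhds_iff.1 hS
  exact asymptotically_stable_of_lyapunov (lt_min (by norm_num) (by positivity)) hm hr
    (lyapunovForm_lower_bound hb hcb) (continuous_lyapunovForm b c).continuousAt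
    (by simp [lyapunovForm])
    (fun p hp => lyapunovOrbitalDeriv_le hb hc hm ha0 hca hcb hcab hεle.1 hεle.2.1
      (fun i => by linarith [hmle.2 i]) (by linarith [hmle.1]) (hball (by simpa using hp)).le)
    (fun sol h t ht => (h t ht).continuousAt) (fun sol h t ht => h.hasDerivAt_lyapunovForm c ht)

end DesingularizedSystem

/-- local asymptotic stability of the origin for system (pp4).
For the polynomial ODE system
`x̄₁' = −a₁ x̄₁ + b z̄`, `x̄ⱼ' = −aⱼ x̄ⱼ (j = 2,…,k−1)`,
`z̄' = −(z̄^k + Σ_{i=1}^{k-1} x̄ᵢ z̄^{i−1})`,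
with `aᵢ > 0` and `b > 0`, the origin is locally asymptotically stable.
Here `x̄ : Fin (k-1) → ℝ` is 0-indexed, so the paper's `x̄ᵢ` is `x̄ ⟨i-1,_⟩` and
`z̄^{i−1}` is `z̄ ^ (i : ℕ)` for `i : Fin (k-1)`. -/
theorem desingularized_system_local_asymptotic_stability
    (k : ℕ) (hk : 2 ≤ k)
    (a : Fin (k - 1) → ℝ) (ha : ∀ i, 0 < a i)
    (b : ℝ) (hb : 0 < b) :
    -- (i) Lyapunov stability of the origin
    (∀ η > (0 : ℝ), ∃ δ > (0 : ℝ),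
      ∀ sol : ℝ → (Fin (k - 1) → ℝ) × ℝ,
        (∀ t : ℝ, 0 ≤ t → HasDerivAt sol
          ((fun i => (if i = (⟨0, by omega⟩ : Fin (k - 1)) then b * (sol t).2 else 0)
              - a i * (sol t).1 i,
            -(((sol t).2) ^ k
                + ∑ i : Fin (k - 1), (sol t).1 i * ((sol t).2) ^ (i : ℕ))) ) t) →
        ‖sol 0‖ < δ → ∀ t : ℝ, 0 ≤ t → ‖sol t‖ < η) ∧
    -- (ii) local attractivity of the origin
    (∃ δ₀ > (0 : ℝ),
      ∀ sol : ℝ → (Fin (k - 1) → ℝ) × ℝ,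
        (∀ t : ℝ, 0 ≤ t → HasDerivAt sol
          ((fun i => (if i = (⟨0, by omega⟩ : Fin (k - 1)) then b * (sol t).2 else 0)
              - a i * (sol t).1 i,
            -(((sol t).2) ^ k
                + ∑ i : Fin (k - 1), (sol t).1 i * ((sol t).2) ^ (i : ℕ))) ) t) →
        ‖sol 0‖ < δ₀ → Tendsto sol atTop (nhds 0)) := by
  obtain ⟨n, rfl⟩ := Nat.exists_eq_add_of_le' hk
  exact desingularizedSolution_asymptotically_stable (n := n) ha hb
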